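/- Let m be odd and let f : GF(2^m) → 𝔽_2 be balanced, semi-bent, and quadratic (all derivatives affine). Let T = {α ∈ GF(2^m) : Ŵ_f(α) = 0}. Then T is an 𝔽_2-linear subspace of GF(2^m) of dimension m−1, and there exists a unique nonzero w ∈ GF(2^m) such that T^⊥ = {0, w}; moreover Σ_{x ∈ GF(2^m)} (−1)^{f(x)+f(x+b)} equals 2^m if b = 0, equals −2^m if b = w, and equals 0 for every other b ∈ GF(2^m). -/

import Mathlib

open Finset
noncomputable section
open scoped Classical

/-- `GF n` is the finite field with `2^n` elements. -/
abbrev GF (n : ℕ) : Type := GaloisField 2 n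

noncomputable instance (n : ℕ) : Fintype (GF n) := Fintype.ofFinite _

/-- The absolute trace map `GF n → 𝔽₂`. -/
def tr {n : ℕ} (x : GF n) : ZMod 2 := Algebra.trace (ZMod 2) (GF n) x

/-- The Walsh transform of a Boolean function `f : GF m → 𝔽₂` at `a`. -/
def walshB {m : ℕ} (f : GF m → ZMod 2) (a : GF m) : ℤ :=
  ∑ x : GF m, (-1 : ℤ) ^ (f x + tr (a * x)).val

theorem tr_add {n : ℕ} (x y : GF n) : tr (x + y) = tr x + tr y :=
  map_add (Algebra.trace (ZMod 2) (GF n)) x y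

theorem tr_zero {n : ℕ} : tr (0 : GF n) = 0 :=
  map_zero (Algebra.trace (ZMod 2) (GF n))

theorem zmod_two_eq (y : ZMod 2) : y = 0 ∨ y = 1 := by
  revert y; decide

/-- The sign `(-1)^y` of a bit `y`. -/
def bitSign (y : ZMod 2) : ℤ := (-1 : ℤ) ^ y.val

theorem bitSign_add (x y : ZMod 2) : bitSign (x + y) = bitSign x * bitSign y := by
  revert x y; unfold bitSign; decide

theorem bitSign_zero : bitSign 0 = 1 := by
  unfold bitSign; decide

theorem bitSign_one : bitSign 1 = -1 := by
  unfold bitSign; decide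

theorem bitSign_eq (y : ZMod 2) : bitSign y = 1 - 2 * (if y = 1 then 1 else 0) := by
  rcases zmod_two_eq y with rfl | rfl
  · simp [bitSign_zero]
  · simp [bitSign_one]

theorem bitSign_mul_self (y : ZMod 2) : bitSign y * bitSign y = 1 := by
  revert y; unfold bitSign; decide

theorem GF.card {m : ℕ} (hm : m ≠ 0) : (univ : Finset (GF m)).card = 2 ^ m := by
  rw [Finset.card_univ, ← Nat.card_eq_fintype_card]
  exact GaloisField.card 2 m hm

theorem GF.add_self {m : ℕ} (x : GF m) : x + x = 0 := CharTwo.add_self_eq_zero x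

/-- The trace form is nondegenerate. -/
theorem exists_tr_mul_eq_one {m : ℕ} {w : GF m} (hw : w ≠ 0) : ∃ y : GF m, tr (w * y) = 1 := by
  by_contra! h
  apply hw
  refine (traceForm_nondegenerate (ZMod 2) (GF m)).1 w fun y => ?_
  exact (zmod_two_eq (tr (w * y))).resolve_right (h y)

theorem sum_bitSign_tr {m : ℕ} (hm : m ≠ 0) (b : GF m) :
    ∑ x : GF m, bitSign (tr (b * x)) = if b = 0 then 2 ^ m else 0 := by
  split_ifs with hb
  · subst hb
    simp [tr_zero, bitSign_zero, GF.card hm, -Finset.card_univ]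
  · obtain ⟨c, hc⟩ := exists_tr_mul_eq_one hb
    have h := Equiv.sum_comp (Equiv.addRight c) (fun x : GF m => bitSign (tr (b * x)))
    simp only [Equiv.coe_addRight, mul_add, tr_add, bitSign_add, hc, bitSign_one,
      ← Finset.sum_mul] at h
    linarith

/-- The autocorrelation of a Boolean function. -/
def autocorr {m : ℕ} (f : GF m → ZMod 2) (b : GF m) : ℤ :=
  ∑ x : GF m, bitSign (f x + f (x + b))

theorem autocorr_zero {m : ℕ} (hm : m ≠ 0) (f : GF m → ZMod 2) : autocorr f 0 = 2 ^ m := by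
  simp [autocorr, bitSign_add, bitSign_mul_self, GF.card hm, -Finset.card_univ]

theorem walshB_sq {m : ℕ} (f : GF m → ZMod 2) (a : GF m) :
    walshB f a ^ 2 = ∑ b : GF m, autocorr f b * bitSign (tr (a * b)) := by
  have hW : walshB f a = ∑ x : GF m, bitSign (f x + tr (a * x)) := rfl
  rw [sq, hW, Finset.sum_mul_sum]
  simp only [autocorr, Finset.sum_mul]
  rw [Finset.sum_comm (s := (univ : Finset (GF m)))
    (f := fun b x => bitSign (f x + f (x + b)) * bitSign (tr (a * b)))]
  refine Finset.sum_congr rfl fun x _ => ?_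
  rw [← Equiv.sum_comp (Equiv.addLeft x)]
  refine Finset.sum_congr rfl fun b _ => ?_
  simp only [Equiv.coe_addLeft, mul_add, tr_add, bitSign_add]
  linear_combination (bitSign (f x) * bitSign (f (x + b)) * bitSign (tr (a * b))) *
    bitSign_mul_self (tr (a * x))

theorem sum_walshB_sq_mul {m : ℕ} (hm : m ≠ 0) (f : GF m → ZMod 2) (b : GF m) :
    ∑ a : GF m, walshB f a ^ 2 * bitSign (tr (a * b)) = 2 ^ m * autocorr f b := by
  simp only [walshB_sq, Finset.sum_mul]
  rw [Finset.sum_comm]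
  have key : ∀ c : GF m, ∑ a : GF m, autocorr f c * bitSign (tr (a * c)) * bitSign (tr (a * b))
      = if c = b then 2 ^ m * autocorr f b else 0 := by
    intro c
    have : ∀ a : GF m, autocorr f c * bitSign (tr (a * c)) * bitSign (tr (a * b))
        = autocorr f c * bitSign (tr ((c + b) * a)) := by
      intro a
      rw [mul_assoc, ← bitSign_add, ← tr_add, ← mul_add, mul_comm a]
    simp only [this, ← Finset.mul_sum, sum_bitSign_tr hm, CharTwo.add_eq_zero]
    split_ifs with h
    · rw [h, mul_comm]
    · rw [mul_zero]
  simp [key]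

theorem sum_autocorr_sq {m : ℕ} (hm : m ≠ 0) (f : GF m → ZMod 2) :
    2 ^ m * ∑ b : GF m, autocorr f b ^ 2 = ∑ a : GF m, walshB f a ^ 4 := by
  have h : ∀ a : GF m, walshB f a ^ 4 =
      ∑ b : GF m, autocorr f b * (walshB f a ^ 2 * bitSign (tr (a * b))) := by
    intro a
    calc walshB f a ^ 4 = walshB f a ^ 2 * walshB f a ^ 2 := by ring
      _ = walshB f a ^ 2 * ∑ b : GF m, autocorr f b * bitSign (tr (a * b)) := by
        rw [← walshB_sq]
      _ = _ := by
        rw [Finset.mul_sum]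
        exact Finset.sum_congr rfl fun b _ => by ring
  simp only [h]
  rw [Finset.sum_comm]
  simp only [← Finset.mul_sum, sum_walshB_sq_mul hm]
  rw [Finset.mul_sum]
  exact Finset.sum_congr rfl fun b _ => by ring

theorem walshB_zero_of_balanced {m : ℕ} (hm : m ≠ 0) {f : GF m → ZMod 2}
    (hbal : (univ.filter (fun x : GF m => f x = 1)).card = 2 ^ (m - 1)) : walshB f 0 = 0 := by
  have hW : walshB f 0 = ∑ x : GF m, bitSign (f x + tr (0 * x)) := rfl
  rw [hW]
  simp only [zero_mul, tr_zero, add_zero, bitSign_eq, Finset.sum_sub_distrib, ← Finset.mul_sum,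
    Finset.sum_boole, Finset.sum_const, GF.card hm, hbal]
  obtain ⟨n, rfl⟩ := Nat.exists_eq_succ_of_ne_zero hm
  simp [pow_succ]
  ring

theorem autocorr_of_affine_derivative {m : ℕ} (hm : m ≠ 0) {f : GF m → ZMod 2} {b a : GF m}
    {ε : ZMod 2} (h : ∀ x : GF m, f x + f (x + b) = tr (a * x) + ε) :
    autocorr f b = 0 ∨ autocorr f b = 2 ^ m ∨ autocorr f b = -2 ^ m := by
  simp only [autocorr, h, bitSign_add, ← Finset.sum_mul, sum_bitSign_tr hm]
  split_ifs
  · rcases zmod_two_eq ε with rfl | rfl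
    · simp [bitSign_zero]
    · simp [bitSign_one]
  · simp

/-- A vector orthogonal to the hyperplane `w^⊥` is `0` or `w`. -/
theorem eq_zero_or_eq_of_tr_orthogonal {m : ℕ} {w x : GF m} (hw : w ≠ 0)
    (h : ∀ y : GF m, tr (w * y) = 0 → tr (x * y) = 0) : x = 0 ∨ x = w := by
  obtain ⟨z, hz⟩ := exists_tr_mul_eq_one hw
  have hy : ∀ y : GF m, tr (w * y) = 1 → tr (x * y) = tr (x * z) := by
    intro y hy
    have h1 := h (y + z) (by rw [mul_add, tr_add, hy, hz]; decide)
    rw [mul_add, tr_add] at h1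
    exact CharTwo.add_eq_zero.1 h1
  rcases zmod_two_eq (tr (x * z)) with h0 | h1
  · left
    by_contra hx
    obtain ⟨y, hxy⟩ := exists_tr_mul_eq_one hx
    rcases zmod_two_eq (tr (w * y)) with h2 | h2
    · exact zero_ne_one ((h y h2).symm.trans hxy)
    · exact zero_ne_one ((h0.symm.trans (hy y h2).symm).trans hxy)
  · right
    by_contra hx
    obtain ⟨y, hxy⟩ := exists_tr_mul_eq_one (mt CharTwo.add_eq_zero.1 hx)
    rw [add_mul, tr_add] at hxy
    rcases zmod_two_eq (tr (w * y)) with h2 | h2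
    · rw [h y h2, h2] at hxy
      exact absurd hxy (by decide)
    · rw [hy y h2, h1, h2] at hxy
      exact absurd hxy (by decide)

/-- The linear functional `y ↦ tr (w * y)`. -/
def trMul {m : ℕ} (w : GF m) : Module.Dual (ZMod 2) (GF m) :=
  Algebra.traceForm (ZMod 2) (GF m) w

theorem trMul_apply {m : ℕ} (w y : GF m) : trMul w y = tr (w * y) := rfl

theorem finrank_ker_trMul {m : ℕ} (hm : m ≠ 0) {w : GF m} (hw : w ≠ 0) :
    Module.finrank (ZMod 2) (LinearMap.ker (trMul w)) = m - 1 := by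
  have hne : trMul w ≠ 0 := by
    intro h
    obtain ⟨y, hy⟩ := exists_tr_mul_eq_one hw
    rw [← trMul_apply, h] at hy
    exact zero_ne_one hy
  have h := Module.Dual.finrank_ker_add_one_of_ne_zero hne
  rw [GaloisField.finrank 2 hm] at h
  omega

/-- The support of the autocorrelation of a quadratic semi-bent function has two elements. -/
theorem card_support_autocorr {k : ℕ} {f : GF (2 * k + 1) → ZMod 2}
    (hsb : ∀ a, walshB f a ∈ ({0, 2 ^ (k + 1), -(2 ^ (k + 1))} : Set ℤ))
    (hr : ∀ b, autocorr f b = 0 ∨ autocorr f b = 2 ^ (2 * k + 1) ∨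
      autocorr f b = -2 ^ (2 * k + 1)) :
    (univ.filter (fun b => autocorr f b ≠ 0)).card = 2 := by
  have hm : 2 * k + 1 ≠ 0 := by omega
  have h4 : ∀ a, walshB f a ^ 4 = 2 * 2 ^ (2 * k + 1) * walshB f a ^ 2 := by
    intro a
    have h := hsb a
    simp only [Set.mem_insert_iff, Set.mem_singleton_iff] at h
    rcases h with h | h | h <;> rw [h] <;> ring
  have hP := sum_walshB_sq_mul hm f 0
  simp only [mul_zero, tr_zero, bitSign_zero, mul_one, autocorr_zero hm] at hP
  have hS := sum_autocorr_sq hm f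
  simp only [h4, ← Finset.mul_sum, hP] at hS
  have hr2 : ∀ b, autocorr f b ^ 2 =
      (2 ^ (2 * k + 1)) ^ 2 * (if autocorr f b ≠ 0 then 1 else 0) := by
    intro b
    rcases hr b with h | h | h <;> rw [h] <;> simp
  simp only [hr2, ← Finset.mul_sum, Finset.sum_boole] at hS
  have hpos : (2 ^ (2 * k + 1) : ℤ) ^ 3 ≠ 0 := by positivity
  have h2 : (((univ.filter (fun b => autocorr f b ≠ 0)).card : ℕ) : ℤ) = 2 :=
    mul_left_cancel₀ hpos (by linear_combination hS)
  exact_mod_cast h2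

/-- for a balanced quadratic semi-bent function `f` on `GF(2^m)`,
`m = 2k+1` odd, the set `T = {α : Ŵ_f(α) = 0}` is an `𝔽₂`-subspace of dimension `m-1`,
and there is a unique nonzero `w` with `T^⊥ = {0,w}`; moreover
`Σ_x (-1)^(f(x)+f(x+b))` equals `2^m` if `b = 0`, `-2^m` if `b = w`, and `0` otherwise. -/
theorem stmt9 (m k : ℕ) (hm : m = 2 * k + 1)
    (f : GF m → ZMod 2)
    (hbal : (univ.filter (fun x : GF m => f x = 1)).card = 2 ^ (m - 1))
    (hsb : ∀ a : GF m, walshB f a ∈ ({0, 2 ^ (k + 1), -(2 ^ (k + 1))} : Set ℤ))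
    (hquad : ∀ b : GF m, ∃ (a : GF m) (ε : ZMod 2),
      ∀ x : GF m, f x + f (x + b) = tr (a * x) + ε) :
    (∃ T : Submodule (ZMod 2) (GF m),
      (T : Set (GF m)) = {α : GF m | walshB f α = 0} ∧
      Module.finrank (ZMod 2) T = m - 1) ∧
    (∃! w : GF m, w ≠ 0 ∧
      {x : GF m | ∀ y : GF m, walshB f y = 0 → tr (x * y) = 0} = {0, w} ∧
      ∀ b : GF m, (∑ x : GF m, (-1 : ℤ) ^ (f x + f (x + b)).val)
        = if b = 0 then 2 ^ m else if b = w then -(2 ^ m) else 0) := by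
  subst hm
  have hm : 2 * k + 1 ≠ 0 := by omega
  have hr : ∀ b, autocorr f b = 0 ∨ autocorr f b = 2 ^ (2 * k + 1) ∨
      autocorr f b = -2 ^ (2 * k + 1) := by
    intro b
    obtain ⟨a, ε, h⟩ := hquad b
    exact autocorr_of_affine_derivative hm h
  have hpos : (2 ^ (2 * k + 1) : ℤ) ≠ 0 := by positivity
  have hr0 := autocorr_zero hm f
  have hmem0 : (0 : GF (2 * k + 1)) ∈ univ.filter (fun b => autocorr f b ≠ 0) := by
    simp [hr0]
  obtain ⟨w, hw0, hw⟩ : ∃ w : GF (2 * k + 1), w ≠ 0 ∧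
      univ.filter (fun b => autocorr f b ≠ 0) = {0, w} := by
    obtain ⟨x, y, hxy, h⟩ := Finset.card_eq_two.1 (card_support_autocorr hsb hr)
    rw [h, Finset.mem_insert, Finset.mem_singleton] at hmem0
    rcases hmem0 with rfl | rfl
    · exact ⟨y, hxy.symm, h⟩
    · exact ⟨x, hxy, h.trans (Finset.pair_comm _ _)⟩
  have hsupp : ∀ b, autocorr f b ≠ 0 ↔ b = 0 ∨ b = w := by
    intro b
    have h := Finset.ext_iff.1 hw b
    simpa using h
  have hsq : ∀ a, walshB f a ^ 2 =
      2 ^ (2 * k + 1) + autocorr f w * bitSign (tr (a * w)) := by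
    intro a
    rw [walshB_sq, ← Finset.sum_subset (Finset.subset_univ {0, w}), Finset.sum_pair hw0.symm, hr0,
      mul_zero, tr_zero, bitSign_zero, mul_one]
    intro b _ hb
    rw [← hw, Finset.mem_filter, not_and_not_right] at hb
    simp [hb (Finset.mem_univ b)]
  have hrw : autocorr f w = -2 ^ (2 * k + 1) := by
    have h := hsq 0
    rw [walshB_zero_of_balanced hm hbal, zero_mul, tr_zero, bitSign_zero] at h
    linarith
  have hT : ∀ a, walshB f a = 0 ↔ tr (w * a) = 0 := by
    intro a
    rw [← sq_eq_zero_iff, hsq, hrw, mul_comm w]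
    rcases zmod_two_eq (tr (a * w)) with h | h
    · simp [h, bitSign_zero]
    · rw [h, bitSign_one]
      simp only [one_ne_zero, iff_false]
      intro h'
      apply hpos
      linarith
  refine ⟨⟨LinearMap.ker (trMul w), ?_, finrank_ker_trMul hm hw0⟩, w, ⟨hw0, ?_, ?_⟩, ?_⟩
  · ext a
    simp [hT, trMul_apply]
  · ext x
    simp only [hT, Set.mem_ofPred_eq, Set.mem_insert_iff, Set.mem_singleton_iff]
    refine ⟨eq_zero_or_eq_of_tr_orthogonal hw0, ?_⟩
    rintro (rfl | rfl) y hy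
    · rw [zero_mul, tr_zero]
    · exact hy
  · intro b
    change autocorr f b = _
    split_ifs with h0 h1
    · rw [h0, hr0]
    · rw [h1, hrw]
    · by_contra h
      exact ((hsupp b).1 h).elim h0 h1
  · rintro v ⟨hv0, hv, -⟩
    have hwmem : v ∈ ({0, v} : Set (GF (2 * k + 1))) := by simp
    rw [← hv] at hwmem
    simp only [hT, Set.mem_ofPred_eq] at hwmem
    exact (eq_zero_or_eq_of_tr_orthogonal hw0 hwmem).resolve_left hv0
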